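/- arXiv:0805.1810 — 2 statements merged into one kernel-verified Lean document; each statement's English description precedes it below -/
import Mathlib

section
/- For m, n ∈ ℕ, let G_{m,n} = ⟨s, t | s² = t^m = (st⁻¹st)^n = 1⟩. Then G_{m,n} is finite if and only if m = 1, or m = 2, or n = 1, or (m,n) = (3,2). -/
/-- The relations of the group `G_{m,n} = ⟨s, t | s², tᵐ, (st⁻¹st)ⁿ⟩`. -/
def relsGmn (m n : ℕ) : Set (FreeGroup (Fin 2)) :=
  letI s : FreeGroup (Fin 2) := FreeGroup.of 0
  letI t : FreeGroup (Fin 2) := FreeGroup.of 1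
  {s ^ 2, t ^ m, (s * t⁻¹ * s * t) ^ n}

open Module Polynomial.Chebyshev

/-! ### Finiteness -/

/-- A group generated by `a` and `b` is finite as soon as some finite set containing `1` is
stable under left multiplication by `a` and `b`. -/
lemma finite_of_mul_mem {G : Type*} [Group G] {a b : G} (hab : Subgroup.closure {a, b} = ⊤)
    {A : Set G} (hA : A.Finite) (h1 : 1 ∈ A) (ha : ∀ x ∈ A, a * x ∈ A)
    (hb : ∀ x ∈ A, b * x ∈ A) : Finite G := by
  open scoped Pointwise in
  have key : ∀ g : G, (∀ x ∈ A, g * x ∈ A) → g ∈ MulAction.stabilizer G A := by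
    intro g hg
    rw [MulAction.mem_stabilizer_iff]
    refine Set.eq_of_subset_of_ncard_le ?_ ?_ hA
    · rintro _ ⟨x, hx, rfl⟩
      exact hg x hx
    · exact (Set.ncard_image_of_injective A (MulAction.injective g)).ge
  have htop : MulAction.stabilizer G A = ⊤ := by
    rw [eq_top_iff, ← hab, Subgroup.closure_le]
    rintro x (rfl | rfl)
    exacts [key _ ha, key _ hb]
  refine Set.finite_univ_iff.mp (hA.subset fun g _ ↦ ?_)
  have hg : g ∈ MulAction.stabilizer G A := htop ▸ Subgroup.mem_top g
  rw [MulAction.mem_stabilizer_iff] at hg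
  rw [← hg]
  exact ⟨1, h1, mul_one g⟩

lemma finite_zpowers_of_pow_eq_one {G : Type*} [Group G] {a : G} {n : ℕ} (hn : 0 < n)
    (h : a ^ n = 1) : (Subgroup.zpowers a : Set G).Finite :=
  finite_zpowers.mpr (isOfFinOrder_iff_pow_eq_one.mpr ⟨n, hn, h⟩)

lemma finite_of_commute {G : Type*} [Group G] {a b : G} (hab : Subgroup.closure {a, b} = ⊤)
    {k l : ℕ} (hk : 0 < k) (hl : 0 < l) (ha : a ^ k = 1) (hb : b ^ l = 1) (hc : Commute a b) :
    Finite G := by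
  open scoped Pointwise in
  refine finite_of_mul_mem hab (A := (Subgroup.zpowers a : Set G) * (Subgroup.zpowers b : Set G))
    ((finite_zpowers_of_pow_eq_one hk ha).mul (finite_zpowers_of_pow_eq_one hl hb))
    ⟨1, one_mem _, 1, one_mem _, one_mul 1⟩ ?_ ?_
  · rintro _ ⟨x, hx, y, hy, rfl⟩
    exact ⟨a * x, mul_mem (Subgroup.mem_zpowers a) hx, y, hy, mul_assoc _ _ _⟩
  · rintro _ ⟨_, ⟨i, rfl⟩, y, hy, rfl⟩
    refine ⟨a ^ i, ⟨i, rfl⟩, b * y, mul_mem (Subgroup.mem_zpowers b) hy, ?_⟩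
    simp only [← mul_assoc]
    rw [(hc.zpow_left i).eq]

lemma finite_of_dihedral {G : Type*} [Group G] {a b : G} (hab : Subgroup.closure {a, b} = ⊤)
    {k : ℕ} (hk : 0 < k) (ha : a ^ 2 = 1) (hb : b ^ 2 = 1) (h : (a * b) ^ k = 1) :
    Finite G := by
  have ha' : a * a = 1 := by rw [← sq, ha]
  have hb' : b * b = 1 := by rw [← sq, hb]
  have hconj : ∀ i : ℤ, a * (a * b) ^ i = (a * b) ^ (-i) * a := by
    intro i
    have : a * (a * b) * a⁻¹ = (a * b)⁻¹ := by
      rw [mul_inv_rev, inv_eq_of_mul_eq_one_right ha', inv_eq_of_mul_eq_one_right hb',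
        ← mul_assoc, ha', one_mul]
    rw [zpow_neg, ← inv_zpow, ← this, conj_zpow]
    group
  have hs : ∀ i j : ℤ, a * ((a * b) ^ i * a ^ j) = (a * b) ^ (-i) * a ^ (j + 1) := by
    intro i j
    rw [← mul_assoc, hconj, mul_assoc, ← zpow_one_add, add_comm]
  have hb2 : b = (a * b) ^ (-1 : ℤ) * a := by
    rw [zpow_neg_one, mul_inv_rev, inv_mul_cancel_right, inv_eq_of_mul_eq_one_right hb']
  open scoped Pointwise in
  refine finite_of_mul_mem hab
    (A := (Subgroup.zpowers (a * b) : Set G) * (Subgroup.zpowers a : Set G))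
    ((finite_zpowers_of_pow_eq_one hk h).mul (finite_zpowers_of_pow_eq_one two_pos ha))
    ⟨1, one_mem _, 1, one_mem _, one_mul 1⟩ ?_ ?_
  · rintro _ ⟨_, ⟨i, rfl⟩, _, ⟨j, rfl⟩, rfl⟩
    exact ⟨_, ⟨-i, rfl⟩, _, ⟨j + 1, rfl⟩, (hs i j).symm⟩
  · rintro _ ⟨_, ⟨i, rfl⟩, _, ⟨j, rfl⟩, rfl⟩
    refine ⟨_, ⟨-1 + -i, rfl⟩, _, ⟨j + 1, rfl⟩, ?_⟩
    calc (a * b) ^ (-1 + -i) * a ^ (j + 1)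
        = (a * b) ^ (-1 : ℤ) * (a * ((a * b) ^ i * a ^ j)) := by rw [hs, zpow_add, mul_assoc]
      _ = b * ((a * b) ^ i * a ^ j) := by rw [← mul_assoc, ← hb2]

lemma finite_of_three_two {G : Type*} [Group G] {a b : G} (hab : Subgroup.closure {a, b} = ⊤)
    (ha : a ^ 2 = 1) (hb : b ^ 3 = 1) (h : (a * b⁻¹ * a * b) ^ 2 = 1) : Finite G := by
  have ha' : a * a = 1 := by rw [← sq, ha]
  have hainv : a⁻¹ = a := inv_eq_of_mul_eq_one_right ha'
  obtain ⟨p, hp⟩ : ∃ p, p = b * a * b⁻¹ := ⟨_, rfl⟩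
  obtain ⟨q, hq⟩ : ∃ q, q = b * p * b⁻¹ := ⟨_, rfl⟩
  have hbq : a = b * q * b⁻¹ := by
    have hb3 : b * b * b = 1 := by rw [← hb, pow_succ, sq]
    calc a = (b * b * b) * a * (b * b * b)⁻¹ := by rw [hb3]; simp
      _ = b * q * b⁻¹ := by rw [hq, hp]; group
  have hp2 : p ^ 2 = 1 := by rw [hp, conj_pow, ha]; group
  have hq2 : q ^ 2 = 1 := by rw [hq, conj_pow, hp2]; group
  have hqa : q = b⁻¹ * a * b := by rw [hbq]; group
  have haq : Commute a q := by
    have h2 : (a * q) * (a * q) = 1 := by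
      rw [← sq, ← h, hqa]; group
    have := eq_inv_of_mul_eq_one_left h2
    rw [mul_inv_rev, hainv, inv_eq_of_mul_eq_one_right (by rw [← sq, hq2])] at this
    exact this
  have hconj {u v : G} (huv : Commute u v) : Commute (b * u * b⁻¹) (b * v * b⁻¹) :=
    huv.map (MulAut.conj b).toMonoidHom
  have hpa : Commute p a := by simpa only [← hp, ← hbq] using hconj haq
  have hca : ∀ i j k l : ℤ, b * (a ^ i * p ^ j * q ^ k * b ^ l) =
      a ^ k * p ^ i * q ^ j * b ^ (1 + l) := by
    intro i j k l
    have e : b * (a ^ i * p ^ j * q ^ k * b ^ l) =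
      (b * a * b⁻¹) ^ i * (b * p * b⁻¹) ^ j * (b * q * b⁻¹) ^ k * (b * b ^ l) := by
      simp only [conj_zpow]; group
    rw [e, ← hp, ← hq, ← hbq, zpow_one_add]
    congr 1
    rw [((hpa.zpow_zpow i k).mul_left (haq.symm.zpow_zpow j k)).eq, ← mul_assoc]
  open scoped Pointwise in
  refine finite_of_mul_mem hab
    (A := (Subgroup.zpowers a : Set G) * (Subgroup.zpowers p : Set G) *
      (Subgroup.zpowers q : Set G) * (Subgroup.zpowers b : Set G))
    ((((finite_zpowers_of_pow_eq_one two_pos ha).mul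
      (finite_zpowers_of_pow_eq_one two_pos hp2)).mul
      (finite_zpowers_of_pow_eq_one two_pos hq2)).mul
      (finite_zpowers_of_pow_eq_one three_pos hb)) ?_ ?_ ?_
  · exact ⟨1, ⟨1, ⟨1, one_mem _, 1, one_mem _, one_mul 1⟩, 1, one_mem _, one_mul 1⟩, 1, one_mem _,
      one_mul 1⟩
  · rintro _ ⟨_, ⟨_, ⟨_, ⟨i, rfl⟩, _, ⟨j, rfl⟩, rfl⟩, _, ⟨k, rfl⟩, rfl⟩, _, ⟨l, rfl⟩, rfl⟩
    refine ⟨_, ⟨_, ⟨_, ⟨1 + i, rfl⟩, _, ⟨j, rfl⟩, rfl⟩, _, ⟨k, rfl⟩, rfl⟩, _, ⟨l, rfl⟩, ?_⟩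
    simp only [zpow_one_add, mul_assoc]
  · rintro _ ⟨_, ⟨_, ⟨_, ⟨i, rfl⟩, _, ⟨j, rfl⟩, rfl⟩, _, ⟨k, rfl⟩, rfl⟩, _, ⟨l, rfl⟩, rfl⟩
    exact ⟨_, ⟨_, ⟨_, ⟨k, rfl⟩, _, ⟨i, rfl⟩, rfl⟩, _, ⟨j, rfl⟩, rfl⟩, _, ⟨1 + l, rfl⟩,
      (hca i j k l).symm⟩

/-! ### Products of two reflections -/

section Reflection

variable {V : Type*} [AddCommGroup V] [Module ℝ V] {x y : V} {f g : Dual ℝ V}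

lemma reflection_mul_reflection_pow_eq_one (hf : f x = 2) (hg : g y = 2) {n : ℕ} (hn : 2 ≤ n)
    (hfy : f y = -2 * Real.cos (Real.pi / n)) (hgx : g x = -2 * Real.cos (Real.pi / n)) :
    (reflection hf * reflection hg) ^ n = 1 := by
  obtain rfl | hn3 : n = 2 ∨ 3 ≤ n := by lia
  · simp only [Nat.cast_ofNat, Real.cos_pi_div_two, mul_zero] at hfy hgx
    ext z
    simp only [sq, LinearEquiv.mul_apply, reflection_apply, map_sub, map_smul, hf, hg, hfy, hgx,
      LinearEquiv.coe_one, id]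
    module
  have ht : 2 * Real.cos (2 * (Real.pi / n)) = f y * g x - 2 := by
    rw [hfy, hgx, Real.cos_two_mul]; ring
  have hn0 : (n : ℝ) ≠ 0 := by positivity
  obtain ⟨θ, hθ⟩ : ∃ θ, θ = 2 * (Real.pi / n) := ⟨_, rfl⟩
  have hnθ : n * θ = 2 * Real.pi := by rw [hθ]; field_simp
  have hsin : Real.sin θ ≠ 0 := by
    refine (Real.sin_pos_of_pos_of_lt_pi (by rw [hθ]; positivity) ?_).ne'
    have : (3 : ℝ) ≤ n := by exact_mod_cast hn3
    have := Real.pi_pos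
    rw [hθ, ← mul_div_assoc, div_lt_iff₀ (by positivity)]
    nlinarith
  rw [← hθ] at ht
  ext z
  rw [reflection_mul_reflection_pow_apply hf hg n z _ ht]
  obtain ⟨k, rfl | rfl⟩ := n.even_or_odd'
  · have hS : (S ℝ ((k : ℤ) - 1)).eval (2 * Real.cos θ) = 0 := by
      have := S_two_mul_real_cos θ ((k : ℤ) - 1)
      have e : (((k : ℤ) - 1 : ℤ) + 1 : ℝ) * θ = Real.pi := by
        push_cast at hnθ ⊢; linarith
      rw [e, Real.sin_pi] at this
      exact (mul_eq_zero.mp this).resolve_right hsin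
    have e1 : (((2 * k : ℕ) : ℤ) - 2) / 2 = k - 1 := by lia
    have e2 : (((2 * k : ℕ) : ℤ) - 1) / 2 = k - 1 := by lia
    rw [e1, e2, hS]
    simp
  · have hS : (S ℝ (k : ℤ)).eval (2 * Real.cos θ) + (S ℝ ((k : ℤ) - 1)).eval (2 * Real.cos θ)
        = 0 := by
      have h1 := S_two_mul_real_cos θ ((k : ℤ) - 1)
      have h2 := S_two_mul_real_cos θ (k : ℤ)
      have e : ((k : ℤ) + 1 : ℝ) * θ = 2 * Real.pi - (((k : ℤ) - 1 : ℤ) + 1 : ℝ) * θ := by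
        push_cast at hnθ ⊢; linarith
      rw [e, Real.sin_two_pi_sub] at h2
      exact (mul_eq_zero.mp (by rw [add_mul, h1, h2]; ring)).resolve_right hsin
    have e1 : (((2 * k + 1 : ℕ) : ℤ) - 3) / 2 = k - 1 := by lia
    have e2 : (((2 * k + 1 : ℕ) : ℤ) - 1) / 2 = k := by lia
    have e3 : (((2 * k + 1 : ℕ) : ℤ)) / 2 = k := by lia
    have e4 : (((2 * k + 1 : ℕ) : ℤ) - 2) / 2 = k - 1 := by lia
    rw [e1, e2, e3, e4, hS]
    simp

/-- Two reflections whose roots satisfy `f y, g x ≤ -2` generate an infinite dihedral group. -/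
lemma reflection_mul_reflection_pow_ne_one (hf : f x = 2) (hg : g y = 2)
    (hfy : f y ≤ -2) (hgx : g x ≤ -2) {φ : Dual ℝ V} (hx : φ x = 1) (hy : φ y = 0)
    {n : ℕ} (hn : 0 < n) : (reflection hf * reflection hg) ^ n ≠ 1 := by
  have key : ∀ j : ℕ, ∃ p q : ℝ, ((reflection hf * reflection hg) ^ j) x = p • x + q • y ∧
      j + 1 ≤ p ∧ 0 ≤ q ∧ q + 1 ≤ p := by
    intro j
    induction j with
    | zero => exact ⟨1, 0, by simp, by simp, le_rfl, by simp⟩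
    | succ j ih =>
      obtain ⟨p, q, h, hp, hq, hqp⟩ := ih
      obtain ⟨q', hq'⟩ : ∃ q', q' = -g x * p - q := ⟨_, rfl⟩
      obtain ⟨p', hp'⟩ : ∃ p', p' = -f y * q' - p := ⟨_, rfl⟩
      have h1 : p + 1 ≤ q' := by nlinarith
      have h2 : q' + 1 ≤ p' := by nlinarith
      refine ⟨p', q', ?_, by push_cast; linarith, by linarith, h2⟩
      rw [pow_succ', LinearEquiv.mul_apply, h, LinearEquiv.mul_apply]
      simp only [reflection_apply, map_add, map_sub, map_smul, hf, hg, hp', hq']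
      match_scalars <;> ring
  intro h1
  obtain ⟨p, q, h, hp, -, -⟩ := key n
  rw [h1] at h
  have := congrArg φ h
  simp only [LinearEquiv.coe_one, id, map_add, map_smul, hx, hy, smul_eq_mul, mul_zero, mul_one,
    add_zero] at this
  have : (0 : ℝ) < n := by exact_mod_cast hn
  linarith

lemma inv_mul_reflection_mul (hf : f x = 2) (u : V ≃ₗ[ℝ] V)
    (h : (f ∘ₗ u.toLinearMap) (u⁻¹ x) = 2) :
    u⁻¹ * reflection hf * u = reflection h := by
  ext z
  simp [reflection_apply, LinearEquiv.mul_apply]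

/-- A representation sending `s` to a reflection and `u⁻¹ * s * u` to a sufficiently remote
reflection forces the group to be infinite. -/
lemma infinite_of_reflection {G : Type*} [Group G] (ρ : G →* V ≃ₗ[ℝ] V) {s u : G}
    (hf : f x = 2) (hs : ρ s = reflection hf) (h₁ : f ((ρ u)⁻¹ x) ≤ -2) (h₂ : f (ρ u x) ≤ -2)
    {φ : Dual ℝ V} (hx : φ x = 1) (hy : φ ((ρ u)⁻¹ x) = 0) : Infinite G := by
  rw [← not_finite_iff_infinite]
  intro hG
  have hg : (f ∘ₗ (ρ u).toLinearMap) ((ρ u)⁻¹ x) = 2 := by simpa using hf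
  obtain ⟨n, hn, h⟩ := (isOfFinOrder_of_finite (s * (u⁻¹ * s * u))).exists_pow_eq_one
  refine reflection_mul_reflection_pow_ne_one hf hg h₁ h₂ hx hy hn ?_
  rw [← inv_mul_reflection_mul hf (ρ u) hg, ← hs, ← map_inv, ← map_mul, ← map_mul, ← map_mul,
    ← map_pow, h, map_one]

end Reflection

/-! ### The circulant reflection representation -/

section Circulant

variable {m : ℕ}

/-- The cyclic shift of the coordinates of `ZMod m → ℝ`. -/
def cyclicShift (m : ℕ) : (ZMod m → ℝ) ≃ₗ[ℝ] (ZMod m → ℝ) :=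
  LinearEquiv.funCongrLeft ℝ ℝ (Equiv.addRight 1)

lemma cyclicShift_apply (v : ZMod m → ℝ) (i : ZMod m) : cyclicShift m v i = v (i + 1) := rfl

lemma cyclicShift_pow_apply (k : ℕ) (v : ZMod m → ℝ) (i : ZMod m) :
    (cyclicShift m ^ k) v i = v (i + k) := by
  induction k generalizing i with
  | zero => simp
  | succ k ih =>
    rw [pow_succ', LinearEquiv.mul_apply, cyclicShift_apply, ih]
    push_cast
    ring_nf

lemma cyclicShift_pow_self (m : ℕ) : cyclicShift m ^ m = 1 := by
  ext v i
  simp [cyclicShift_pow_apply]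

lemma cyclicShift_single (i : ZMod m) :
    cyclicShift m (Pi.single i 1) = Pi.single (i - 1) 1 := by
  ext j
  simp [cyclicShift_apply, Pi.single_apply, eq_sub_iff_add_eq]

lemma cyclicShift_inv_single (i : ZMod m) :
    (cyclicShift m)⁻¹ (Pi.single i 1) = Pi.single (i + 1) 1 := by
  have h : cyclicShift m (Pi.single (i + 1) 1) = Pi.single i 1 := by simp [cyclicShift_single]
  rw [← h]
  exact (cyclicShift m).symm_apply_apply _

variable [NeZero m]

/-- Twice the linear form with coefficients `b`. -/
noncomputable def rootForm (b : ZMod m → ℝ) : Dual ℝ (ZMod m → ℝ) :=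
  ∑ i, (2 * b i) • LinearMap.proj i

lemma rootForm_single (b : ZMod m → ℝ) (i : ZMod m) :
    rootForm b (Pi.single i 1) = 2 * b i := by
  simp [rootForm, Pi.single_apply]

lemma exists_reflection_representation {n : ℕ} (hn : 2 ≤ n) {b : ZMod m → ℝ}
    (h0 : rootForm b (Pi.single 0 1) = 2) (h1 : b 1 = -Real.cos (Real.pi / n))
    (h1' : b (-1) = -Real.cos (Real.pi / n)) :
    ∃ ρ : PresentedGroup (relsGmn m n) →* (ZMod m → ℝ) ≃ₗ[ℝ] (ZMod m → ℝ),
      ρ (.of 0) = reflection h0 ∧ ρ (.of 1) = cyclicShift m := by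
  have h : ∀ r ∈ relsGmn m n, FreeGroup.lift ![reflection h0, cyclicShift m] r = 1 := by
    rintro r (rfl | rfl | rfl)
    · simp only [map_pow, FreeGroup.lift_apply_of, Matrix.cons_val_zero]
      ext1 v
      exact involutive_reflection h0 v
    · simpa using cyclicShift_pow_self m
    · have hg : (rootForm b ∘ₗ (cyclicShift m).toLinearMap)
          ((cyclicShift m)⁻¹ (Pi.single 0 1)) = 2 := by simpa using h0
      have := reflection_mul_reflection_pow_eq_one h0 hg hn
        (by rw [cyclicShift_inv_single, rootForm_single, zero_add, h1]; ring)
        (by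
          rw [LinearMap.comp_apply, LinearEquiv.coe_coe, cyclicShift_single, rootForm_single,
            zero_sub, h1']
          ring)
      rw [← inv_mul_reflection_mul h0] at this
      simpa [mul_assoc] using this
  exact ⟨PresentedGroup.toGroup h, by simp, by simp⟩

end Circulant

lemma infinite_of_four_le {m n : ℕ} (hm : 4 ≤ m) (hn : 2 ≤ n) :
    Infinite (PresentedGroup (relsGmn m n)) := by
  have : NeZero m := ⟨by lia⟩
  have e1 : (1 : ZMod m) ≠ 0 := fun h ↦ by
    have := Nat.le_of_dvd (by simp) ((ZMod.natCast_eq_zero_iff 1 m).mp (by exact_mod_cast h)); lia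
  have e2 : (2 : ZMod m) ≠ 0 := fun h ↦ by
    have := Nat.le_of_dvd (by simp) ((ZMod.natCast_eq_zero_iff 2 m).mp (by exact_mod_cast h)); lia
  have e3 : (3 : ZMod m) ≠ 0 := fun h ↦ by
    have := Nat.le_of_dvd (by simp) ((ZMod.natCast_eq_zero_iff 3 m).mp (by exact_mod_cast h)); lia
  obtain ⟨b, hb⟩ : ∃ b : ZMod m → ℝ, b = fun i ↦ if i = 0 then 1 else
    if i = 1 ∨ i = -1 then -Real.cos (Real.pi / n) else -1 := ⟨_, rfl⟩
  have b2 : b 2 = -1 := by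
    have : ¬ ((2 : ZMod m) = 1 ∨ (2 : ZMod m) = -1) := by
      rintro (h | h)
      · exact e1 (by linear_combination h)
      · exact e3 (by linear_combination h)
    simp [hb, e2, this]
  have b2' : b (-2) = -1 := by
    have : ¬ ((-2 : ZMod m) = 1 ∨ (-2 : ZMod m) = -1) := by
      rintro (h | h)
      · exact e3 (by linear_combination -h)
      · exact e1 (by linear_combination -h)
    simp only [hb, neg_eq_zero, e2, this, if_false]
  have h0 : rootForm b (Pi.single 0 1) = 2 := by simp [rootForm_single, hb]
  obtain ⟨ρ, hs, ht⟩ := exists_reflection_representation hn h0 (by simp [hb, e1])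
    (by simp [hb, e1])
  have hu : ρ (.of 1 ^ 2) (Pi.single 0 1) = Pi.single (-2) 1 := by
    rw [map_pow, ht, sq, LinearEquiv.mul_apply, cyclicShift_single, cyclicShift_single]
    congr 1; ring
  have hu' : (ρ (.of 1 ^ 2))⁻¹ (Pi.single 0 1) = Pi.single 2 1 := by
    rw [map_pow, ht, sq, mul_inv_rev, LinearEquiv.mul_apply, cyclicShift_inv_single,
      cyclicShift_inv_single]
    congr 1; ring
  refine infinite_of_reflection ρ (u := .of 1 ^ 2) (φ := LinearMap.proj 0) h0 hs ?_ ?_ ?_ ?_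
  · rw [hu', rootForm_single, b2]; norm_num
  · rw [hu, rootForm_single, b2']; norm_num
  · simp
  · rw [hu']; simp [e2.symm]

lemma infinite_of_three {n : ℕ} (hn : 3 ≤ n) :
    Infinite (PresentedGroup (relsGmn 3 n)) := by
  obtain ⟨c, hc⟩ : ∃ c, c = Real.cos (Real.pi / n) := ⟨_, rfl⟩
  have hc2 : 1 / 2 ≤ c := by
    have h3 : (3 : ℝ) ≤ n := by exact_mod_cast hn
    have := Real.pi_pos
    rw [hc, ← Real.cos_pi_div_three]
    exact Real.cos_le_cos_of_nonneg_of_le_pi (by positivity) (by linarith) (by gcongr)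
  obtain ⟨b, hb⟩ : ∃ b : ZMod 3 → ℝ, b = fun i ↦ if i = 0 then 1 else -c := ⟨_, rfl⟩
  have b1 : b 1 = -c := by simp [hb]
  have b2 : b 2 = -c := by rw [hb]; exact if_neg (by decide)
  have h0 : rootForm b (Pi.single 0 1) = 2 := by simp [rootForm_single, hb]
  obtain ⟨ρ, hs, ht⟩ := exists_reflection_representation (n := n) (by lia) h0 (by rw [b1, hc])
    (by rw [← hc]; exact b2)
  have hu : ρ (.of 1 * .of 0 * .of 1) (Pi.single 0 1) =
      Pi.single 1 1 + (2 * c) • Pi.single 2 1 := by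
    rw [map_mul, map_mul, hs, ht, LinearEquiv.mul_apply, LinearEquiv.mul_apply, cyclicShift_single,
      show (0 - 1 : ZMod 3) = 2 by decide, reflection_apply, rootForm_single, b2, map_sub, map_smul,
      cyclicShift_single, cyclicShift_single, show (0 - 1 : ZMod 3) = 2 by decide,
      show (2 - 1 : ZMod 3) = 1 by decide]
    module
  have hu' : (ρ (.of 1 * .of 0 * .of 1))⁻¹ (Pi.single 0 1) =
      Pi.single 2 1 + (2 * c) • Pi.single 1 1 := by
    rw [map_mul, map_mul, hs, ht, mul_inv_rev, mul_inv_rev, reflection_inv, LinearEquiv.mul_apply,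
      LinearEquiv.mul_apply, cyclicShift_inv_single, zero_add, reflection_apply, rootForm_single,
      b1, map_sub, map_smul, cyclicShift_inv_single, cyclicShift_inv_single, zero_add,
      show (1 + 1 : ZMod 3) = 2 by decide]
    module
  refine infinite_of_reflection ρ (u := .of 1 * .of 0 * .of 1) (φ := LinearMap.proj 0)
    h0 hs ?_ ?_ ?_ ?_
  · rw [hu', map_add, map_smul, rootForm_single, rootForm_single, b1, b2, smul_eq_mul]; nlinarith
  · rw [hu, map_add, map_smul, rootForm_single, rootForm_single, b1, b2, smul_eq_mul]; nlinarith
  · simp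
  · rw [hu']
    simp [show (0 : ZMod 3) ≠ 2 by decide]

/-- `G_{m,n}` is finite iff `m = 1`, `m = 2`, `n = 1` or `(m,n) = (3,2)`. -/
theorem stmt8 (m n : ℕ) (hm : 0 < m) (hn : 0 < n) :
    Finite (PresentedGroup (relsGmn m n)) ↔
      m = 1 ∨ m = 2 ∨ n = 1 ∨ (m = 3 ∧ n = 2) := by
  constructor
  · contrapose!
    rintro ⟨h1, h2, h3, h4⟩
    obtain rfl | hm4 : m = 3 ∨ 4 ≤ m := by lia
    · exact infinite_of_three (by have := h4 rfl; lia)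
    · exact infinite_of_four_le hm4 (by lia)
  have hab : Subgroup.closure {PresentedGroup.of 0, PresentedGroup.of 1} =
      (⊤ : Subgroup (PresentedGroup (relsGmn m n))) := by
    rw [← PresentedGroup.closure_range_of]
    congr 1
    ext x
    simp [Fin.exists_fin_two, eq_comm]
  obtain ⟨a, ha⟩ : ∃ a : PresentedGroup (relsGmn m n), a = .of 0 := ⟨_, rfl⟩
  obtain ⟨b, hb⟩ : ∃ b : PresentedGroup (relsGmn m n), b = .of 1 := ⟨_, rfl⟩
  have ha2 : a ^ 2 = 1 := by
    rw [ha]; exact PresentedGroup.one_of_mem (rels := relsGmn m n) (.inl rfl)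
  have hbm : b ^ m = 1 := by
    rw [hb]; exact PresentedGroup.one_of_mem (rels := relsGmn m n) (.inr (.inl rfl))
  have habn : (a * b⁻¹ * a * b) ^ n = 1 := by
    rw [ha, hb]; exact PresentedGroup.one_of_mem (rels := relsGmn m n) (.inr (.inr rfl))
  rw [← ha, ← hb] at hab
  rintro (rfl | rfl | rfl | ⟨rfl, rfl⟩)
  · rw [pow_one] at hbm
    exact finite_of_commute hab two_pos one_pos ha2 (by rw [hbm, one_pow])
      (by rw [hbm]; exact Commute.one_right a)
  · refine finite_of_dihedral hab (k := 2 * n) (by lia) ha2 hbm ?_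
    rw [pow_mul, ← habn, inv_eq_of_mul_eq_one_right (by rw [← sq, hbm]), sq]
    simp only [mul_assoc]
  · refine finite_of_commute hab two_pos hm ha2 hbm ?_
    rw [pow_one, mul_assoc] at habn
    have h := eq_inv_of_mul_eq_one_right habn
    rw [mul_inv_rev, inv_inv, inv_eq_of_mul_eq_one_right (by rw [← sq, ha2])] at h
    exact h
  · exact finite_of_three_two hab ha2 hbm habn
end

section
/- For m, n, p ∈ ℕ, the group G_{m,n,p} = ⟨s, u, t | s², u², t^m, (st⁻¹ut)^n, (su)^p⟩ is finite if and only if m = 1, or (n,p) = (1,1), or (m,n) = (2,1), or (m,p) = (2,1), or (m,n,p) = (3,1,2), or (m,n,p) = (3,2,1). -/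
/-- The relations of `G_{m,n,p} = ⟨s, u, t | s², u², tᵐ, (st⁻¹ut)ⁿ, (su)ᵖ⟩`,
where the generators `0, 1, 2` are `s, u, t` respectively. -/
def relsGmnp (m n p : ℕ) : Set (FreeGroup (Fin 3)) :=
  letI s : FreeGroup (Fin 3) := FreeGroup.of 0
  letI u : FreeGroup (Fin 3) := FreeGroup.of 1
  letI t : FreeGroup (Fin 3) := FreeGroup.of 2
  {s ^ 2, u ^ 2, t ^ m, (s * t⁻¹ * u * t) ^ n, (s * u) ^ p}

/-! ### The finite cases -/

section Finite

open scoped Pointwise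

variable {G : Type*} [Group G]

theorem finite_of_closure_of_mul_mem {S T : Set G} (hS : Subgroup.closure S = ⊤)
    (hT : T.Finite) (h1 : 1 ∈ T) (h : ∀ g ∈ S, ∀ x ∈ T, g * x ∈ T) : Finite G := by
  have hle : Subgroup.closure S ≤ MulAction.stabilizer G T := by
    rw [Subgroup.closure_le]
    intro g hg
    exact (MulAction.mem_stabilizer_set' hT).2 fun x hx => h g hg x hx
  rw [hS] at hle
  have huniv : T = Set.univ := by
    refine Set.eq_univ_of_forall fun g => ?_
    simpa using (MulAction.mem_stabilizer_set' hT).1 (hle (Subgroup.mem_top g)) h1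
  exact Set.finite_univ_iff.1 (huniv ▸ hT)

theorem finite_range_zpow {g : G} {n : ℕ} (hn : 0 < n) (hg : g ^ n = 1) :
    (Set.range fun k : ℤ => g ^ k).Finite :=
  (isOfFinOrder_iff_pow_eq_one.2 ⟨n, hn, hg⟩).finite_zpowers

/-- A group generated by two involutions whose product has finite order is finite. -/
theorem finite_of_closure_involutions {x y : G} (hxy : Subgroup.closure {x, y} = ⊤)
    (hx : x ^ 2 = 1) (hy : y ^ 2 = 1) {k : ℕ} (hk : 0 < k) (h : (x * y) ^ k = 1) :
    Finite G := by
  rw [sq] at hx hy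
  have hfin := finite_range_zpow hk h
  have hconj (j : ℤ) : x * (x * y) ^ j = (x * y) ^ (-j) * x := by
    have h2 : x * (x * y) * x⁻¹ = (x * y)⁻¹ := by
      rw [inv_eq_of_mul_eq_one_left hx, mul_inv_rev, inv_eq_of_mul_eq_one_left hx,
        inv_eq_of_mul_eq_one_left hy, ← mul_assoc, hx, one_mul]
    rw [zpow_neg, ← inv_zpow, ← h2, conj_zpow]
    group
  have hx' (j : ℤ) : x * ((x * y) ^ j * x) = (x * y) ^ (-j) := by
    rw [← mul_assoc, hconj, mul_assoc, hx, mul_one]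
  have hyx (j : ℤ) : y * (x * y) ^ j = x * (x * y) ^ (1 + j) := by
    rw [zpow_add, zpow_one, ← mul_assoc x, ← mul_assoc x, hx, one_mul]
  refine finite_of_closure_of_mul_mem hxy (hfin.union (hfin.image (· * x)))
    (Or.inl ⟨0, zpow_zero _⟩) ?_
  rintro g (rfl | rfl) _ (⟨j, rfl⟩ | ⟨_, ⟨j, rfl⟩, rfl⟩)
  · exact Or.inr ⟨_, ⟨-j, rfl⟩, (hconj j).symm⟩
  · exact Or.inl ⟨-j, (hx' j).symm⟩
  · exact Or.inr ⟨_, ⟨-(1 + j), rfl⟩, ((hyx j).trans (hconj _)).symm⟩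
  · refine Or.inl ⟨-(1 + j), ?_⟩
    simp only [← hx', ← mul_assoc, hyx]

/-- A group generated by an involution `s` and an element `t` of order dividing three such that
`s` commutes with its conjugate by `t` is finite. -/
theorem finite_of_closure_commute_conj {s t : G} (hst : Subgroup.closure {s, t} = ⊤)
    (hs : s ^ 2 = 1) (ht : t ^ 3 = 1) (h : Commute s (t * s * t⁻¹)) : Finite G := by
  obtain ⟨b, hb⟩ : ∃ b, b = t * s * t⁻¹ := ⟨_, rfl⟩
  obtain ⟨c, hc⟩ : ∃ c, c = t * b * t⁻¹ := ⟨_, rfl⟩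
  have ha : s = t * c * t⁻¹ := by
    have : t * c * t⁻¹ = t ^ 3 * s * (t ^ 3)⁻¹ := by
      rw [hc, hb]; simp only [pow_succ, pow_zero, mul_inv_rev, mul_assoc, one_mul]
    rw [this, ht]; group
  rw [← hb] at h
  have hbc : Commute b c := by
    have := h.conj t
    rwa [← hb, ← hc] at this
  have hca : Commute c s := by
    have := hbc.conj t
    rwa [← hc, ← ha] at this
  have hb2 : b ^ 2 = 1 := by rw [hb, conj_pow, hs]; group
  have hc2 : c ^ 2 = 1 := by rw [hc, conj_pow, hb2]; group
  have hs' := finite_range_zpow two_pos hs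
  have hb' := finite_range_zpow two_pos hb2
  have hc' := finite_range_zpow two_pos hc2
  have ht' := finite_range_zpow three_pos ht
  have htb (j : ℤ) : t * s ^ j = b ^ j * t := by rw [hb, conj_zpow]; group
  have htc (j : ℤ) : t * b ^ j = c ^ j * t := by rw [hc, conj_zpow]; group
  have hta (j : ℤ) : t * c ^ j = s ^ j * t := by
    conv_rhs => rw [ha, conj_zpow]
    group
  have hfin : {x : G | ∃ i j k l : ℤ, x = s ^ i * b ^ j * c ^ k * t ^ l}.Finite := by
    refine (((hs'.mul hb').mul hc').mul ht').subset ?_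
    rintro _ ⟨i, j, k, l, rfl⟩
    exact Set.mul_mem_mul (Set.mul_mem_mul (Set.mul_mem_mul ⟨i, rfl⟩ ⟨j, rfl⟩) ⟨k, rfl⟩) ⟨l, rfl⟩
  refine finite_of_closure_of_mul_mem hst hfin ⟨0, 0, 0, 0, by simp⟩ ?_
  rintro g (rfl | rfl) _ ⟨i, j, k, l, rfl⟩
  · refine ⟨1 + i, j, k, l, ?_⟩
    rw [zpow_add, zpow_one]
    simp only [mul_assoc]
  · refine ⟨k, i, j, 1 + l, ?_⟩
    have h1 : b ^ i * c ^ j * s ^ k = s ^ k * b ^ i * c ^ j := by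
      rw [mul_assoc, (hca.zpow_zpow j k).eq, ← mul_assoc, ← (h.zpow_zpow k i).eq]
    rw [← h1, zpow_add, zpow_one]
    simp only [← mul_assoc]
    rw [htb, mul_assoc (b ^ i), htc, ← mul_assoc, mul_assoc (b ^ i * c ^ j), hta, ← mul_assoc]

/-- A group generated by commuting elements of finite order is finite. -/
theorem finite_of_closure_commute {s t : G} (hst : Subgroup.closure {s, t} = ⊤)
    {k l : ℕ} (hk : 0 < k) (hl : 0 < l) (hs : s ^ k = 1) (ht : t ^ l = 1) (h : Commute s t) :
    Finite G := by
  have hs' := finite_range_zpow hk hs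
  have ht' := finite_range_zpow hl ht
  refine finite_of_closure_of_mul_mem hst (hs'.mul ht')
    ⟨_, ⟨0, rfl⟩, _, ⟨0, rfl⟩, by simp⟩ ?_
  rintro g (rfl | rfl) _ ⟨_, ⟨i, rfl⟩, _, ⟨j, rfl⟩, rfl⟩
  · exact ⟨_, ⟨1 + i, rfl⟩, _, ⟨j, rfl⟩, by simp [zpow_add, mul_assoc]⟩
  · refine ⟨_, ⟨i, rfl⟩, _, ⟨1 + j, rfl⟩, ?_⟩
    simp only [zpow_add, zpow_one, ← mul_assoc, (h.zpow_left i).eq]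

end Finite

theorem finite_presentedGroup_relsGmnp {m n p : ℕ} (hm : 0 < m) (hn : 0 < n) (hp : 0 < p)
    (h : m = 1 ∨ (n = 1 ∧ p = 1) ∨ (m = 2 ∧ n = 1) ∨ (m = 2 ∧ p = 1) ∨
      (m = 3 ∧ n = 1 ∧ p = 2) ∨ (m = 3 ∧ n = 2 ∧ p = 1)) :
    Finite (PresentedGroup (relsGmnp m n p)) := by
  have rel {r} (hr : r ∈ relsGmnp m n p) : PresentedGroup.mk (relsGmnp m n p) r = 1 :=
    PresentedGroup.one_of_mem hr
  obtain ⟨s, hs⟩ : ∃ s, s = PresentedGroup.of (rels := relsGmnp m n p) 0 := ⟨_, rfl⟩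
  obtain ⟨u, hu⟩ : ∃ u, u = PresentedGroup.of (rels := relsGmnp m n p) 1 := ⟨_, rfl⟩
  obtain ⟨t, ht⟩ : ∃ t, t = PresentedGroup.of (rels := relsGmnp m n p) 2 := ⟨_, rfl⟩
  have hs2 : s ^ 2 = 1 := hs ▸ rel (r := FreeGroup.of 0 ^ 2) (by simp [relsGmnp])
  have hu2 : u ^ 2 = 1 := hu ▸ rel (r := FreeGroup.of 1 ^ 2) (by simp [relsGmnp])
  have htm : t ^ m = 1 := ht ▸ rel (r := FreeGroup.of 2 ^ m) (by simp [relsGmnp])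
  have hsutn : (s * t⁻¹ * u * t) ^ n = 1 := hs ▸ hu ▸ ht ▸
    rel (r := (FreeGroup.of 0 * (FreeGroup.of 2)⁻¹ * FreeGroup.of 1 * FreeGroup.of 2) ^ n)
      (by simp [relsGmnp])
  have hsup : (s * u) ^ p = 1 := hs ▸ hu ▸
    rel (r := (FreeGroup.of 0 * FreeGroup.of 1) ^ p) (by simp [relsGmnp])
  have hcl : Subgroup.closure {s, u, t} = ⊤ := by
    rw [← PresentedGroup.closure_range_of, hs, hu, ht]
    congr 1
    ext x
    simp [Fin.exists_fin_succ, eq_comm]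
  have hsinv : s⁻¹ = s := inv_eq_of_mul_eq_one_left (by rw [← sq, hs2])
  have huinv : u⁻¹ = u := inv_eq_of_mul_eq_one_left (by rw [← sq, hu2])
  have gen_st (h : u ∈ Subgroup.closure {s, t}) : Subgroup.closure {s, t} = ⊤ := by
    rw [eq_top_iff, ← hcl, Subgroup.closure_le]
    rintro x (rfl | rfl | rfl)
    · exact Subgroup.subset_closure (by simp)
    · exact h
    · exact Subgroup.subset_closure (by simp)
  have hs_mem : s ∈ Subgroup.closure {s, t} := Subgroup.subset_closure (by simp)
  have ht_mem : t ∈ Subgroup.closure {s, t} := Subgroup.subset_closure (by simp)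
  have hu_of_p (h : p = 1) : u = s := by
    have h1 : s * u = 1 := (pow_one _).symm.trans ((congrArg ((s * u) ^ ·) h.symm).trans hsup)
    rw [← hsinv, eq_inv_of_mul_eq_one_right h1]
  have hu_of_n (h : n = 1) : u = t * s * t⁻¹ := by
    have h1 : s * t⁻¹ * u * t = 1 :=
      (pow_one _).symm.trans ((congrArg ((s * t⁻¹ * u * t) ^ ·) h.symm).trans hsutn)
    have : t⁻¹ * u * t = s⁻¹ := eq_inv_of_mul_eq_one_right (by rw [← h1]; group)
    rw [← hsinv, ← this]; group
  rcases h with rfl | ⟨rfl, rfl⟩ | ⟨rfl, rfl⟩ | ⟨rfl, rfl⟩ | ⟨rfl, rfl, rfl⟩ | ⟨rfl, rfl, rfl⟩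
  · rw [pow_one] at htm
    refine finite_of_closure_involutions (x := s) (y := u) ?_ hs2 hu2 hp hsup
    rw [eq_top_iff, ← hcl, Subgroup.closure_le]
    rintro x (rfl | rfl | rfl)
    · exact Subgroup.subset_closure (by simp)
    · exact Subgroup.subset_closure (by simp)
    · rw [htm]; exact one_mem _
  · have hus := hu_of_p rfl
    have hut := hu_of_n rfl
    refine finite_of_closure_commute (gen_st (hus ▸ hs_mem)) two_pos hm hs2 htm ?_
    have h1 : s = t * s * t⁻¹ := hus ▸ hut
    exact mul_inv_eq_iff_eq_mul.1 h1.symm |>.symm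
  · have hut := hu_of_n rfl
    have htinv : t⁻¹ = t := inv_eq_of_mul_eq_one_left (by rw [← sq, htm])
    refine finite_of_closure_involutions
      (gen_st (hut ▸ mul_mem (mul_mem ht_mem hs_mem) (inv_mem ht_mem))) hs2 htm
      (k := 2 * p) (by omega) ?_
    rw [pow_mul, ← hsup, hut, htinv, sq]
    simp only [mul_assoc]
  · have hus := hu_of_p rfl
    have htinv : t⁻¹ = t := inv_eq_of_mul_eq_one_left (by rw [← sq, htm])
    refine finite_of_closure_involutions (gen_st (hus ▸ hs_mem)) hs2 htm
      (k := 2 * n) (by omega) ?_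
    rw [pow_mul, ← hsutn, hus, htinv, sq]
    simp only [mul_assoc]
  · have hut := hu_of_n rfl
    refine finite_of_closure_commute_conj
      (gen_st (hut ▸ mul_mem (mul_mem ht_mem hs_mem) (inv_mem ht_mem))) hs2 htm ?_
    rw [← hut]
    have := eq_inv_of_mul_eq_one_left ((sq (s * u)).symm.trans hsup)
    rwa [mul_inv_rev, hsinv, huinv] at this
  · have hus := hu_of_p rfl
    refine finite_of_closure_commute_conj (gen_st (hus ▸ hs_mem)) hs2 htm ?_
    have h1 : Commute s (t⁻¹ * s * t) := by
      have := eq_inv_of_mul_eq_one_left ((sq (s * t⁻¹ * u * t)).symm.trans hsutn)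
      simp only [mul_inv_rev, hsinv, hus, inv_inv] at this
      rw [commute_iff_eq, ← mul_assoc, ← mul_assoc, this]
      simp only [mul_assoc]
    have h2 := (h1.conj t).symm
    rwa [show t * (t⁻¹ * s * t) * t⁻¹ = s by group] at h2

/-! ### The infinite cases -/

/-- The orthogonal reflection of the plane in the line with direction `L.1` at signed distance
`L.2 / 2` from the origin. -/
noncomputable def lineReflection (L : Circle × ℝ) : Equiv.Perm ℂ :=
  Function.Involutive.toPerm
    (fun z => (L.1 : ℂ) ^ 2 * starRingEnd ℂ z + L.2 * Complex.I * L.1) (by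
      intro z
      have h : (L.1 : ℂ) * starRingEnd ℂ (L.1 : ℂ) = 1 := by
        rw [Complex.mul_conj, Circle.normSq_coe, Complex.ofReal_one]
      simp only [map_add, map_mul, map_pow, Complex.conj_conj, Complex.conj_I, Complex.conj_ofReal]
      linear_combination (z * ((L.1 : ℂ) * starRingEnd ℂ (L.1 : ℂ) + 1)
        - L.2 * Complex.I * L.1) * h)

theorem lineReflection_apply (L : Circle × ℝ) (z : ℂ) :
    lineReflection L z = (L.1 : ℂ) ^ 2 * starRingEnd ℂ z + L.2 * Complex.I * L.1 := rfl

theorem lineReflection_sq (L : Circle × ℝ) : lineReflection L ^ 2 = 1 := by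
  ext1 z
  exact Function.Involutive.toPerm_involutive _ z

/-- Two lines are equal or meet at a nonzero multiple of the angle `π / n`. -/
def MeetAtAngle (n : ℕ) (L M : Circle × ℝ) : Prop :=
  L = M ∨ L.1 ^ 2 ≠ M.1 ^ 2 ∧ (L.1 ^ 2) ^ n = (M.1 ^ 2) ^ n

theorem MeetAtAngle.symm {n : ℕ} {L M : Circle × ℝ} (h : MeetAtAngle n L M) :
    MeetAtAngle n M L :=
  h.imp Eq.symm fun h => ⟨h.1.symm, h.2.symm⟩

theorem Equiv.Perm.pow_eq_one_of_eq_mul_add {K : Type*} [Field K] {f : Equiv.Perm K} {a b : K}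
    (hf : ∀ z, f z = a * z + b) (ha : a ≠ 1) {n : ℕ} (hn : a ^ n = 1) : f ^ n = 1 := by
  have h1 : 1 - a ≠ 0 := sub_ne_zero.2 ha.symm
  obtain ⟨c, hc⟩ : ∃ c, b = c - a * c := ⟨b / (1 - a), by field_simp⟩
  have h (k : ℕ) (z : K) : (f ^ k) z = c + a ^ k * (z - c) := by
    induction k with
    | zero => simp
    | succ k ih => rw [pow_succ', Equiv.Perm.mul_apply, ih, hf, hc]; ring
  ext1 z
  rw [h, hn]
  simp

theorem MeetAtAngle.lineReflection_mul_pow {n : ℕ} {L M : Circle × ℝ} (h : MeetAtAngle n L M) :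
    (lineReflection L * lineReflection M) ^ n = 1 := by
  obtain rfl | ⟨hne, hpow⟩ := h
  · rw [← sq, lineReflection_sq, one_pow]
  refine Equiv.Perm.pow_eq_one_of_eq_mul_add (a := ((L.1 ^ 2 / M.1 ^ 2 : Circle) : ℂ))
    (b := (L.1 : ℂ) ^ 2 * starRingEnd ℂ (M.2 * Complex.I * M.1) + L.2 * Complex.I * L.1) ?_ ?_ ?_
  · intro z
    rw [Equiv.Perm.mul_apply, lineReflection_apply, lineReflection_apply, div_eq_mul_inv,
      Circle.coe_mul, Circle.coe_inv_eq_conj]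
    simp only [map_add, map_mul, map_pow, Complex.conj_conj, Circle.coe_pow]
    ring
  · rw [Ne, Circle.coe_eq_one, div_eq_one]
    exact hne
  · rw [← Circle.coe_pow, div_pow, hpow, div_self', Circle.coe_one]

theorem eq_zero_of_finset_invariant {F : Finset ℂ} (hF : F.Nonempty) {v w : Circle} {r : ℝ}
    (hv : v ^ 2 ≠ 1) (h0 : ∀ z ∈ F, lineReflection (1, 0) z ∈ F)
    (h1 : ∀ z ∈ F, lineReflection (v, 0) z ∈ F) (h2 : ∀ z ∈ F, lineReflection (w, r) z ∈ F) :
    r = 0 := by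
  have key {L : Circle × ℝ} (h : ∀ z ∈ F, lineReflection L z ∈ F) :
      (L.1 : ℂ) ^ 2 * starRingEnd ℂ (∑ z ∈ F, z) + F.card * (L.2 * Complex.I * L.1)
        = ∑ z ∈ F, z := by
    have himg : F.map (lineReflection L).toEmbedding = F := by
      refine Finset.eq_of_subset_of_card_le ?_ (by simp)
      intro y hy
      obtain ⟨z, hz, rfl⟩ := Finset.mem_map.1 hy
      exact h z hz
    conv_rhs => rw [← himg]
    simp [lineReflection_apply, Finset.sum_add_distrib, Finset.mul_sum, map_sum]
  have k0 := key h0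
  have k1 := key h1
  have k2 := key h2
  have hv' : (v : ℂ) ^ 2 ≠ 1 := by
    rw [← Circle.coe_pow, Ne, Circle.coe_eq_one]
    exact hv
  simp only [Circle.coe_one, Complex.ofReal_zero, zero_mul, mul_zero, add_zero, one_pow,
    one_mul] at k0 k1
  rw [k0] at k1 k2
  have hsum : ∑ z ∈ F, z = 0 := by
    by_contra hne
    exact hv' (mul_right_cancel₀ hne (k1.trans (one_mul _).symm))
  simpa [hsum, hF.ne_empty] using k2

/-- The shift of the copies of `X` in `ZMod m × X`. -/
def sigmaShift (m : ℕ) (X : Type*) : Equiv.Perm (Σ _ : ZMod m, X) where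
  toFun x := ⟨x.1 + 1, x.2⟩
  invFun x := ⟨x.1 - 1, x.2⟩
  left_inv x := by simp
  right_inv x := by simp

theorem sigmaShift_pow_apply (m : ℕ) {X : Type*} (k : ℕ) (x : Σ _ : ZMod m, X) :
    (sigmaShift m X ^ k) x = ⟨x.1 + k, x.2⟩ := by
  induction k with
  | zero => simp
  | succ k ih =>
    rw [pow_succ', Equiv.Perm.mul_apply, ih]
    simp [sigmaShift, add_assoc]

/-- The action on `ZMod m × X` of the group `G_{m,n,p}` induced from an action on `X` of the
kernel of its projection to `ZMod m`. -/
theorem exists_hom_of_perms {m n p : ℕ} {X : Type*} {A B : ZMod m → Equiv.Perm X}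
    (hA : ∀ i, A i ^ 2 = 1) (hB : ∀ i, B i ^ 2 = 1) (hn : ∀ i, (A i * B (i + 1)) ^ n = 1)
    (hp : ∀ i, (A i * B i) ^ p = 1) :
    ∃ φ : PresentedGroup (relsGmnp m n p) →* Equiv.Perm (Σ _ : ZMod m, X),
      φ (PresentedGroup.of 0) = Equiv.Perm.sigmaCongrRightHom _ A ∧
      φ (PresentedGroup.of 1) = Equiv.Perm.sigmaCongrRightHom _ B ∧
      φ (PresentedGroup.of 2) = sigmaShift m X := by
  have hconj : (sigmaShift m X)⁻¹ * Equiv.Perm.sigmaCongrRightHom (fun _ => X) B * sigmaShift m X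
      = Equiv.Perm.sigmaCongrRightHom (fun _ => X) fun i => B (i + 1) := by
    rw [mul_assoc, inv_mul_eq_iff_eq_mul]
    ext1 ⟨i, z⟩
    rfl
  have hrels : ∀ r ∈ relsGmnp m n p, FreeGroup.lift
      ![Equiv.Perm.sigmaCongrRightHom (fun _ => X) A,
        Equiv.Perm.sigmaCongrRightHom (fun _ => X) B, sigmaShift m X] r = 1 := by
    rintro r (rfl | rfl | rfl | rfl | rfl)
    · simp only [map_pow, FreeGroup.lift_apply_of, Matrix.cons_val]
      rw [← map_pow, show A ^ 2 = 1 from funext hA, map_one]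
    · simp only [map_pow, FreeGroup.lift_apply_of, Matrix.cons_val]
      rw [← map_pow, show B ^ 2 = 1 from funext hB, map_one]
    · simp only [map_pow, FreeGroup.lift_apply_of, Matrix.cons_val]
      ext1 x
      rw [sigmaShift_pow_apply]
      simp
    · simp only [map_pow, map_mul, map_inv, FreeGroup.lift_apply_of, Matrix.cons_val]
      rw [mul_assoc, mul_assoc, ← mul_assoc (sigmaShift m X)⁻¹, hconj, ← map_mul, ← map_pow,
        show (A * fun i => B (i + 1)) ^ n = 1 from funext hn, map_one]
    · simp only [map_pow, map_mul, FreeGroup.lift_apply_of, Matrix.cons_val]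
      rw [← map_mul, ← map_pow, show (A * B) ^ p = 1 from funext hp, map_one]
  exact ⟨PresentedGroup.toGroup hrels, PresentedGroup.toGroup.of hrels,
    PresentedGroup.toGroup.of hrels, PresentedGroup.toGroup.of hrels⟩

theorem exists_finset_invariant {m n p : ℕ} [NeZero m] {X : Type*} [Nonempty X]
    {A B : ZMod m → Equiv.Perm X}
    (hA : ∀ i, A i ^ 2 = 1) (hB : ∀ i, B i ^ 2 = 1) (hn : ∀ i, (A i * B (i + 1)) ^ n = 1)
    (hp : ∀ i, (A i * B i) ^ p = 1) [Finite (PresentedGroup (relsGmnp m n p))] :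
    ∃ F : Finset X, F.Nonempty ∧ ∀ i, ∀ z ∈ F, A i z ∈ F ∧ B i z ∈ F := by
  obtain ⟨φ, h0, h1, h2⟩ := exists_hom_of_perms hA hB hn hp
  obtain ⟨x⟩ := ‹Nonempty X›
  have hfin := Set.finite_range fun g => (φ g ⟨0, x⟩).2
  refine ⟨hfin.toFinset, ⟨x, by simpa using ⟨1, by simp⟩⟩, fun i z hz => ?_⟩
  obtain ⟨g, rfl⟩ := hfin.mem_toFinset.1 hz
  have hmove : (sigmaShift m X ^ (i - (φ g ⟨0, x⟩).1).val) (φ g ⟨0, x⟩)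
      = ⟨i, (φ g ⟨0, x⟩).2⟩ := by
    rw [sigmaShift_pow_apply]
    simp
  simp only [hfin.mem_toFinset]
  constructor
  · refine ⟨PresentedGroup.of 0 * (PresentedGroup.of 2 ^ (i - (φ g ⟨0, x⟩).1).val * g), ?_⟩
    simp only [map_mul, map_pow, h0, h2, Equiv.Perm.mul_apply, hmove]
    rfl
  · refine ⟨PresentedGroup.of 1 * (PresentedGroup.of 2 ^ (i - (φ g ⟨0, x⟩).1).val * g), ?_⟩
    simp only [map_mul, map_pow, h1, h2, Equiv.Perm.mul_apply, hmove]
    rfl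

theorem not_finite_of_lines {m n p : ℕ} [NeZero m] {A B : ZMod m → Circle × ℝ}
    (hn : ∀ i, MeetAtAngle n (A i) (B (i + 1))) (hp : ∀ i, MeetAtAngle p (A i) (B i))
    {v w : Circle} (hv : v ^ 2 ≠ 1) (h0 : (1, 0) ∈ Set.range A ∪ Set.range B)
    (h1 : (v, 0) ∈ Set.range A ∪ Set.range B) (h2 : (w, 1) ∈ Set.range A ∪ Set.range B) :
    ¬ Finite (PresentedGroup (relsGmnp m n p)) := by
  intro
  obtain ⟨F, hF, h⟩ := exists_finset_invariant (fun i => lineReflection_sq (A i))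
    (fun i => lineReflection_sq (B i)) (fun i => (hn i).lineReflection_mul_pow)
    (fun i => (hp i).lineReflection_mul_pow)
  have key {L} (hL : L ∈ Set.range A ∪ Set.range B) : ∀ z ∈ F, lineReflection L z ∈ F := by
    rcases hL with ⟨i, rfl⟩ | ⟨i, rfl⟩
    · exact fun z hz => (h i z hz).1
    · exact fun z hz => (h i z hz).2
  exact one_ne_zero (eq_zero_of_finset_invariant hF hv (key h0) (key h1) (key h2))

theorem not_finite_of_line_cycle {m q : ℕ} [NeZero m] {A : ZMod m → Circle × ℝ}
    (hq : ∀ i, MeetAtAngle q (A i) (A (i + 1)))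
    {v w : Circle} (hv : v ^ 2 ≠ 1) (h0 : (1, 0) ∈ Set.range A)
    (h1 : (v, 0) ∈ Set.range A) (h2 : (w, 1) ∈ Set.range A) :
    ¬ Finite (PresentedGroup (relsGmnp m q 1)) ∧ ¬ Finite (PresentedGroup (relsGmnp m 1 q)) := by
  refine ⟨not_finite_of_lines (B := A) hq (fun i => Or.inl rfl) hv (Or.inl h0) (Or.inl h1)
    (Or.inl h2), not_finite_of_lines (B := fun i => A (i - 1)) (fun i => Or.inl (by simp))
    (fun i => ?_) hv (Or.inl h0) (Or.inl h1) (Or.inl h2)⟩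
  simpa using (hq (i - 1)).symm

theorem Circle.exists_isPrimitiveRoot {k : ℕ} (hk : k ≠ 0) : ∃ v : Circle, IsPrimitiveRoot v k := by
  refine ⟨Circle.exp (2 * Real.pi / k), IsPrimitiveRoot.of_map_of_injective (f := Circle.coeHom) ?_
    Circle.coe_injective⟩
  convert Complex.isPrimitiveRoot_exp k hk using 1
  refine (Circle.coe_exp _).trans ?_
  push_cast
  congr 1
  ring

theorem Circle.exists_sq_pow_eq_one {q : ℕ} (hq : 2 ≤ q) :
    ∃ v : Circle, (v ^ 2) ^ q = 1 ∧ v ^ 2 ≠ 1 ∧ (3 ≤ q → (v ^ 2) ^ 2 ≠ 1) := by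
  obtain ⟨v, hv⟩ := Circle.exists_isPrimitiveRoot (k := 2 * q) (by omega)
  refine ⟨v, by rw [← pow_mul, hv.pow_eq_one], hv.pow_ne_one_of_pos_of_lt (by omega) (by omega),
    fun h => ?_⟩
  rw [← pow_mul]
  exact hv.pow_ne_one_of_pos_of_lt (by omega) (by omega)

theorem not_finite_of_two_le {m n p : ℕ} (hm : 2 ≤ m) (hn : 2 ≤ n) (hp : 2 ≤ p) :
    ¬ Finite (PresentedGroup (relsGmnp m n p)) := by
  have : NeZero m := ⟨by omega⟩
  have : Fact (1 < m) := ⟨hm⟩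
  obtain ⟨v, hv, hv1, -⟩ := Circle.exists_sq_pow_eq_one hp
  obtain ⟨w, hw, hw1, -⟩ := Circle.exists_sq_pow_eq_one hn
  refine not_finite_of_lines (v := v) (w := v * w)
    (A := fun i => if i = 0 then (1, 0) else (v * w, 1))
    (B := fun i => if i = 0 then (v, 0) else if i = 1 then (w, 0) else (v * w, 1))
    (fun i => ?_) (fun i => ?_) hv1 (Or.inl ⟨0, by simp⟩) (Or.inr ⟨0, by simp⟩)
    (Or.inl ⟨1, by simp⟩)
  · by_cases h0 : i = 0
    · simp [h0, MeetAtAngle, hw, hw1.symm]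
    · by_cases h1 : i + 1 = 0
      · simp [h0, h1, MeetAtAngle, mul_pow, hw, hw1]
      · simp [h0, h1, MeetAtAngle]
  · by_cases h0 : i = 0
    · simp [h0, MeetAtAngle, hv, hv1.symm]
    · by_cases h1 : i = 1
      · simp [h1, MeetAtAngle, mul_pow, hv, hv1]
      · simp [h0, h1, MeetAtAngle]

theorem not_finite_of_four_le {m q : ℕ} (hm : 4 ≤ m) (hq : 2 ≤ q) :
    ¬ Finite (PresentedGroup (relsGmnp m q 1)) ∧ ¬ Finite (PresentedGroup (relsGmnp m 1 q)) := by
  have : NeZero m := ⟨by omega⟩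
  have : Fact (1 < m) := ⟨by omega⟩
  obtain ⟨v, hv, hv1, -⟩ := Circle.exists_sq_pow_eq_one hq
  have hne (k : ℕ) (hk : 0 < k) (hkm : k < m) : (k : ZMod m) ≠ 0 := by
    rw [Ne, ZMod.natCast_eq_zero_iff]
    exact Nat.not_dvd_of_pos_of_lt hk hkm
  have h2 : (2 : ZMod m) ≠ 0 := mod_cast hne 2 (by omega) (by omega)
  have h3 : (2 + 1 : ZMod m) ≠ 0 := mod_cast hne 3 (by omega) (by omega)
  have h12 : (1 : ZMod m) ≠ 2 := by
    rw [← one_add_one_eq_two]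
    simp
  refine not_finite_of_line_cycle (v := v) (w := 1)
    (A := fun i => if i = 0 then (1, 0) else if i = 2 then (1, 1) else (v, 0))
    (fun i => ?_) hv1 ⟨0, by simp⟩ ⟨1, by simp [h12]⟩ ⟨2, by simp [h2]⟩
  by_cases i0 : i = 0
  · simp [i0, h12, MeetAtAngle, hv, hv1.symm]
  by_cases i2 : i = 2
  · simp [i2, h2, h3, MeetAtAngle, hv, hv1.symm]
  simp only [i0, i2, if_false]
  split_ifs <;> simp [MeetAtAngle, hv, hv1]

theorem not_finite_of_three_le {q : ℕ} (hq : 3 ≤ q) :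
    ¬ Finite (PresentedGroup (relsGmnp 3 q 1)) ∧ ¬ Finite (PresentedGroup (relsGmnp 3 1 q)) := by
  obtain ⟨v, hv, hv1, hv2⟩ := Circle.exists_sq_pow_eq_one (q := q) (by omega)
  replace hv2 := hv2 hq
  have hvq : ((v ^ 2) ^ 2) ^ q = 1 := by rw [← pow_mul, mul_comm, pow_mul, hv, one_pow]
  have hv3 : v ^ 2 ≠ (v ^ 2) ^ 2 := by
    rw [sq (v ^ 2)]
    simpa using hv1
  refine not_finite_of_line_cycle (v := v) (w := v ^ 2)
    (A := fun i => if i = 0 then (1, 0) else if i = 1 then (v, 0) else (v ^ 2, 1))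
    (fun i => ?_) hv1 ⟨0, rfl⟩ ⟨1, rfl⟩ ⟨2, rfl⟩
  split_ifs <;> simp [MeetAtAngle, hv, hvq, hv1, hv1.symm, hv2, hv2.symm, hv3, hv3.symm]

/-- `G_{m,n,p}` is finite iff `m = 1`, `(n,p) = (1,1)`, `(m,n) = (2,1)`,
`(m,p) = (2,1)`, `(m,n,p) = (3,1,2)`, or `(m,n,p) = (3,2,1)`. -/
theorem stmt11 (m n p : ℕ) (hm : 0 < m) (hn : 0 < n) (hp : 0 < p) :
    Finite (PresentedGroup (relsGmnp m n p)) ↔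
      m = 1 ∨ (n = 1 ∧ p = 1) ∨ (m = 2 ∧ n = 1) ∨ (m = 2 ∧ p = 1) ∨
      (m = 3 ∧ n = 1 ∧ p = 2) ∨ (m = 3 ∧ n = 2 ∧ p = 1) := by
  refine ⟨fun hfin => ?_, finite_presentedGroup_relsGmnp hm hn hp⟩
  by_contra hne
  obtain ⟨h2, h2', h2''⟩ | ⟨h4, rfl, hq⟩ | ⟨h4, rfl, hq⟩ | ⟨rfl, rfl, hq⟩ | ⟨rfl, rfl, hq⟩ :
      (2 ≤ m ∧ 2 ≤ n ∧ 2 ≤ p) ∨ (4 ≤ m ∧ p = 1 ∧ 2 ≤ n) ∨ (4 ≤ m ∧ n = 1 ∧ 2 ≤ p) ∨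
      (m = 3 ∧ p = 1 ∧ 3 ≤ n) ∨ (m = 3 ∧ n = 1 ∧ 3 ≤ p) := by omega
  · exact not_finite_of_two_le h2 h2' h2'' hfin
  · exact (not_finite_of_four_le h4 hq).1 hfin
  · exact (not_finite_of_four_le h4 hq).2 hfin
  · exact (not_finite_of_three_le hq).1 hfin
  · exact (not_finite_of_three_le hq).2 hfin
end
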